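/- arXiv:1910.03718 — 2 statements merged into one kernel-verified Lean document; each statement's English description precedes it below -/
import Mathlib

section
/- Exponential-moment bound (Lemma 1): for every θ > 0, E[exp(θ·μ(X_1 + ⋯ + X_K))] ≤ exp(max(θ, θ^τ) · φ_Ω), where both sides are interpreted as values in [0, ∞]. -/
open MeasureTheory ProbabilityTheory Finset
open scoped ENNReal

noncomputable instance matrixMeasurableSpace (m n : ℕ) :
    MeasurableSpace (Matrix (Fin m) (Fin n) ℂ) :=
  inferInstanceAs (MeasurableSpace ((Fin m) → (Fin n) → ℂ))

/-- A nonnegative function all of whose power moments are dominated by the powers of a constant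
is almost everywhere bounded by that constant. -/
theorem ae_le_of_forall_lintegral_pow_le {α : Type*} [MeasurableSpace α] {ν : Measure α}
    {f : α → ℝ≥0∞} (hf : Measurable f) {c : ℝ≥0∞} (hc0 : c ≠ 0) (hc : c ≠ ∞)
    (h : ∀ j : ℕ, ∫⁻ x, f x ^ j ∂ν ≤ c ^ j) : ∀ᵐ x ∂ν, f x ≤ c := by
  have hmeas : ∀ j : ℕ, Measurable fun x => (f x / c) ^ j :=
    fun j => (hf.div_const c).pow_const j
  have hmoment : ∀ j : ℕ, ∫⁻ x, (f x / c) ^ j ∂ν ≤ 1 := by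
    intro j
    simp_rw [div_eq_mul_inv, mul_pow]
    rw [lintegral_mul_const _ (hf.pow_const j)]
    calc (∫⁻ x, f x ^ j ∂ν) * c⁻¹ ^ j ≤ c ^ j * c⁻¹ ^ j := by gcongr; exact h j
      _ = 1 := by rw [← mul_pow, ENNReal.mul_inv_cancel hc0 hc, one_pow]
  have hfatou : ∫⁻ x, Filter.liminf (fun j : ℕ => (f x / c) ^ j) Filter.atTop ∂ν ≤ 1 :=
    (lintegral_liminf_le hmeas).trans
      ((Filter.liminf_le_liminf (Filter.Eventually.of_forall hmoment)).trans
        (Filter.liminf_const 1).le)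
  filter_upwards [ae_lt_top (Measurable.liminf hmeas)
    (hfatou.trans_lt ENNReal.one_lt_top).ne] with x hx
  by_contra! hlt
  have hone : 1 < f x / c := by
    rwa [ENNReal.lt_div_iff_mul_lt (Or.inl hc0) (Or.inl hc), one_mul]
  exact hx.ne (ENNReal.tendsto_pow_atTop_nhds_top_iff.2 hone).liminf_eq

/-- Over a covering by disjoint nonempty blocks, the sum of a nonnegative function is bounded by
the sum over the blocks of `(max + 1) ^ card - 1`. -/
theorem sum_le_sum_sup'_add_one_pow_sub_one {ι κ : Type*} [Fintype ι] [Fintype κ]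
    (s : ι → Finset κ) (hne : ∀ i, (s i).Nonempty)
    (hdisj : ∀ i j, i ≠ j → Disjoint (s i) (s j)) (hcover : ∀ k, ∃ i, k ∈ s i)
    (b : κ → ℝ) (hb : ∀ k, 0 ≤ b k) :
    ∑ k, b k ≤ ∑ i, (((s i).sup' (hne i) b + 1) ^ (s i).card - 1) := by
  classical
  have huniv : (Finset.univ : Finset κ) = Finset.univ.biUnion s := by
    ext k
    simpa using hcover k
  rw [huniv, Finset.sum_biUnion fun i _ j _ hij => hdisj i j hij]
  refine Finset.sum_le_sum fun i _ => ?_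
  have hsup : ∀ k ∈ s i, b k ≤ (s i).sup' (hne i) b := fun k hk => Finset.le_sup' b hk
  have hnonneg : 0 ≤ (s i).sup' (hne i) b := by
    obtain ⟨k, hk⟩ := hne i
    exact (hb k).trans (hsup k hk)
  have hsum := Finset.sum_le_card_nsmul (s i) b _ hsup
  have hbern := one_add_mul_le_pow (by linarith : (-2 : ℝ) ≤ (s i).sup' (hne i) b) (s i).card
  rw [nsmul_eq_mul] at hsum
  rw [add_comm _ (1 : ℝ)]
  linarith

/-- Exponential-moment bound (Lemma 1): for every `θ > 0`,
`E[exp(θ·μ(X₁+⋯+X_K))] ≤ exp(max(θ, θ^τ) · φ_Ω)`,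
both sides interpreted in `[0, ∞]`. -/
theorem exponential_moment_bound
    (m n : ℕ) (hm : 0 < m) (hn : 0 < n)
    (μ : Matrix (Fin m) (Fin n) ℂ → ℝ)
    (hC1 : ∀ A, 0 ≤ μ A)
    (hC2 : ∀ (θ : ℝ), 0 ≤ θ → ∀ A, μ (θ • A) = θ * μ A)
    (hC3 : ∀ A B, μ (A + B) ≤ μ A + μ B)
    (hμmeas : Measurable μ)
    {Ω' : Type*} [MeasureSpace Ω'] [IsProbabilityMeasure (ℙ : Measure Ω')]
    (K : ℕ) (hK : 0 < K)
    (X : Fin K → Ω' → Matrix (Fin m) (Fin n) ℂ)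
    (hXmeas : ∀ k, Measurable (X k))
    (hindep : iIndepFun X ℙ)
    (B : Fin K → Matrix (Fin m) (Fin n) ℂ)
    (hdom : ∀ θ : ℝ, 0 < θ → ∀ j : ℕ, ∀ k,
      ∫⁻ ω, ENNReal.ofReal ((θ * μ (X k ω) + 1) ^ j) ≤
        ENNReal.ofReal ((θ * μ (B k) + 1) ^ j))
    (I : ℕ) (Part : Fin I → Finset (Fin K))
    (hne : ∀ i, (Part i).Nonempty)
    (hdisj : ∀ i j, i ≠ j → Disjoint (Part i) (Part j))
    (hcover : ∀ k, ∃ i, k ∈ Part i)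
    (τ : ℕ) (hτ : τ = Finset.univ.sup fun i => (Part i).card)
    (φΩ : ℝ)
    (hφΩ : φΩ = ∑ i, ((((Part i).sup' (hne i) fun k => μ (B k)) + 1) ^
      (Part i).card - 1))
    (θ : ℝ) (hθ : 0 < θ) :
    ∫⁻ ω, ENNReal.ofReal (Real.exp (θ * μ (∑ k, X k ω))) ≤
      ENNReal.ofReal (Real.exp (max θ (θ ^ τ) * φΩ)) := by
  have hbound : ∀ k, ∀ᵐ ω, μ (X k ω) ≤ μ (B k) := by
    intro k
    have hpos : 0 < μ (B k) + 1 := by linarith [hC1 (B k)]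
    have hae := ae_le_of_forall_lintegral_pow_le (ν := (ℙ : Measure Ω'))
      (f := fun ω => ENNReal.ofReal (μ (X k ω) + 1)) (c := ENNReal.ofReal (μ (B k) + 1))
      ((hμmeas.comp (hXmeas k)).add_const 1).ennreal_ofReal
      (ENNReal.ofReal_pos.2 hpos).ne' ENNReal.ofReal_ne_top ?_
    · filter_upwards [hae] with ω hω
      linarith [(ENNReal.ofReal_le_ofReal_iff hpos.le).1 hω]
    · intro j
      have hj := hdom 1 one_pos j k
      simp only [one_mul] at hj
      rw [ENNReal.ofReal_pow hpos.le] at hj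
      refine le_of_eq_of_le (lintegral_congr fun ω => ?_) hj
      rw [ENNReal.ofReal_pow (by linarith [hC1 (X k ω)])]
  have hzero : μ 0 = 0 := by simpa using hC2 0 le_rfl 0
  have hsum : ∑ k, μ (B k) ≤ φΩ :=
    hφΩ ▸ sum_le_sum_sup'_add_one_pow_sub_one Part hne hdisj hcover _ fun k => hC1 (B k)
  have hφ : 0 ≤ φΩ := (Finset.sum_nonneg fun k _ => hC1 (B k)).trans hsum
  calc ∫⁻ ω, ENNReal.ofReal (Real.exp (θ * μ (∑ k, X k ω)))
      ≤ ∫⁻ _ : Ω', ENNReal.ofReal (Real.exp (max θ (θ ^ τ) * φΩ)) := by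
        refine lintegral_mono_ae ?_
        filter_upwards [ae_all_iff.2 hbound] with ω hω
        refine ENNReal.ofReal_le_ofReal (Real.exp_le_exp.2 ?_)
        have hμ : μ (∑ k, X k ω) ≤ φΩ :=
          (Finset.le_sum_of_subadditive μ hzero.le hC3 _ _).trans
            ((Finset.sum_le_sum fun k _ => hω k).trans hsum)
        exact (mul_le_mul_of_nonneg_left hμ hθ.le).trans
          (mul_le_mul_of_nonneg_right (le_max_left _ _) hφ)
    _ = ENNReal.ofReal (Real.exp (max θ (θ ^ τ) * φΩ)) := by simp
end

section
/- Clean dimension-free expectation bound (proved in the remark after Theorem 5, via the function g_3(θ,K) = θ^{K+1} + α3(K)): E[μ(X_1 + ⋯ + X_K)] ≤ φ_Ω, for any partition {Ω_1, …, Ω_I} of {1, …, K}. -/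
open MeasureTheory ProbabilityTheory Finset
open scoped ENNReal

/-- A subadditive, positively homogeneous function is bounded on a finite sum by the sum of
its values. -/
theorem map_sum_le_sum_of_sublinear {E ι : Type*} [AddCommGroup E] [Module ℝ E] {p : E → ℝ}
    (hsmul : ∀ θ : ℝ, 0 ≤ θ → ∀ x, p (θ • x) = θ * p x)
    (hadd : ∀ x y, p (x + y) ≤ p x + p y) (s : Finset ι) (f : ι → E) :
    p (∑ i ∈ s, f i) ≤ ∑ i ∈ s, p (f i) :=
  Finset.le_sum_of_subadditive p (by simpa using (hsmul 0 le_rfl 0).le) hadd s f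

/-- If `E[f + 1] ≤ b + 1` under a probability measure, then `E[f] ≤ b`. -/
theorem lintegral_ofReal_le_of_add_one {α : Type*} [MeasurableSpace α] {P : Measure α}
    [IsProbabilityMeasure P] {f : α → ℝ} (hf : ∀ a, 0 ≤ f a) {b : ℝ} (hb : 0 ≤ b)
    (h : ∫⁻ a, ENNReal.ofReal (f a + 1) ∂P ≤ ENNReal.ofReal (b + 1)) :
    ∫⁻ a, ENNReal.ofReal (f a) ∂P ≤ ENNReal.ofReal b := by
  simp only [ENNReal.ofReal_add (hf _) zero_le_one, ENNReal.ofReal_add hb zero_le_one,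
    ENNReal.ofReal_one] at h
  rw [lintegral_add_right _ measurable_const, lintegral_one, measure_univ] at h
  exact (ENNReal.add_le_add_iff_right ENNReal.one_ne_top).1 h

/-- Bernoulli's inequality bounds a sum of nonnegative reals by `(max + 1) ^ card - 1`. -/
theorem sum_le_sup'_add_one_pow_card_sub_one {ι : Type*} {s : Finset ι} (hs : s.Nonempty)
    {b : ι → ℝ} (hb : ∀ k, 0 ≤ b k) :
    ∑ k ∈ s, b k ≤ (s.sup' hs b + 1) ^ s.card - 1 := by
  have hsum : ∑ k ∈ s, b k ≤ s.card * s.sup' hs b := by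
    simpa using Finset.sum_le_card_nsmul s b _ fun k hk => Finset.le_sup' b hk
  have hnonneg : 0 ≤ s.sup' hs b := by
    obtain ⟨k, hk⟩ := hs
    exact (hb k).trans (Finset.le_sup' b hk)
  have hpow := one_add_mul_le_pow (a := s.sup' hs b) (by linarith) s.card
  rw [add_comm 1 (s.sup' hs b)] at hpow
  linarith

/-- Clean dimension-free expectation bound (remark after Theorem 5, via
`g₃(θ,K) = θ^{K+1} + α₃(K)`): `E[μ(X₁+⋯+X_K)] ≤ φ_Ω` for any partition. -/
theorem expectation_bound_clean
    (m n : ℕ) (hm : 0 < m) (hn : 0 < n)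
    (μ : Matrix (Fin m) (Fin n) ℂ → ℝ)
    (hC1 : ∀ A, 0 ≤ μ A)
    (hC2 : ∀ (θ : ℝ), 0 ≤ θ → ∀ A, μ (θ • A) = θ * μ A)
    (hC3 : ∀ A B, μ (A + B) ≤ μ A + μ B)
    (hμmeas : Measurable μ)
    {Ω' : Type*} [MeasureSpace Ω'] [IsProbabilityMeasure (ℙ : Measure Ω')]
    (K : ℕ) (hK : 0 < K)
    (X : Fin K → Ω' → Matrix (Fin m) (Fin n) ℂ)
    (hXmeas : ∀ k, Measurable (X k))
    (hindep : iIndepFun X ℙ)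
    (B : Fin K → Matrix (Fin m) (Fin n) ℂ)
    (hdom : ∀ θ : ℝ, 0 < θ → ∀ j : ℕ, ∀ k,
      ∫⁻ ω, ENNReal.ofReal ((θ * μ (X k ω) + 1) ^ j) ≤
        ENNReal.ofReal ((θ * μ (B k) + 1) ^ j))
    (I : ℕ) (Part : Fin I → Finset (Fin K))
    (hne : ∀ i, (Part i).Nonempty)
    (hdisj : ∀ i j, i ≠ j → Disjoint (Part i) (Part j))
    (hcover : ∀ k, ∃ i, k ∈ Part i)
    (τ : ℕ) (hτ : τ = Finset.univ.sup fun i => (Part i).card)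
    (φΩ : ℝ)
    (hφΩ : φΩ = ∑ i, ((((Part i).sup' (hne i) fun k => μ (B k)) + 1) ^
      (Part i).card - 1))
 :
    ∫⁻ ω, ENNReal.ofReal (μ (∑ k, X k ω)) ≤ ENNReal.ofReal φΩ := by
  have hEB (k : Fin K) : ∫⁻ ω, ENNReal.ofReal (μ (X k ω)) ≤ ENNReal.ofReal (μ (B k)) :=
    lintegral_ofReal_le_of_add_one (fun _ => hC1 _) (hC1 _)
      (by simpa using hdom 1 one_pos 1 k)
  have hpart : ∑ k, μ (B k) = ∑ i, ∑ k ∈ Part i, μ (B k) := by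
    rw [← Finset.sum_biUnion fun i _ j _ hij => hdisj i j hij]
    congr 1
    ext k
    simpa using hcover k
  calc ∫⁻ ω, ENNReal.ofReal (μ (∑ k, X k ω))
      ≤ ∫⁻ ω, ∑ k, ENNReal.ofReal (μ (X k ω)) := by
        refine lintegral_mono fun ω => ?_
        rw [← ENNReal.ofReal_sum_of_nonneg fun k _ => hC1 _]
        exact ENNReal.ofReal_le_ofReal (map_sum_le_sum_of_sublinear hC2 hC3 _ _)
    _ = ∑ k, ∫⁻ ω, ENNReal.ofReal (μ (X k ω)) :=
        MeasureTheory.lintegral_finsetSum _ fun k _ => (hμmeas.comp (hXmeas k)).ennreal_ofReal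
    _ ≤ ∑ k, ENNReal.ofReal (μ (B k)) := Finset.sum_le_sum fun k _ => hEB k
    _ = ENNReal.ofReal (∑ k, μ (B k)) :=
        (ENNReal.ofReal_sum_of_nonneg fun k _ => hC1 _).symm
    _ ≤ ENNReal.ofReal φΩ := by
        rw [hpart, hφΩ]
        exact ENNReal.ofReal_le_ofReal (Finset.sum_le_sum fun i _ =>
          sum_le_sup'_add_one_pow_card_sub_one (hne i) fun k => hC1 (B k))
end
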